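/- Let E be a real normed space, a a continuous linear functional on E with dual norm ‖a‖, x ∈ E, and b, y ∈ ℝ, ξ ≥ 0. Then sup over δ ∈ E with ‖δ‖ ≤ ξ of (y − (a(x + δ) + b))² equals (|y − (a(x) + b)| + ξ‖a‖)². -/

import Mathlib

/-- The squared affine residual on a ball is bounded by its worst-case value. -/
theorem sq_sub_apply_le {E : Type*} [NormedAddCommGroup E] [NormedSpace ℝ E]
    (a : E →L[ℝ] ℝ) (r : ℝ) {ξ : ℝ} {δ : E} (hδ : ‖δ‖ ≤ ξ) :
    (r - a δ) ^ 2 ≤ (|r| + ξ * ‖a‖) ^ 2 := by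
  have hξ : 0 ≤ ξ := (norm_nonneg δ).trans hδ
  have h : |a δ| ≤ ξ * ‖a‖ := by
    rw [mul_comm]
    exact a.le_opNorm_of_le hδ
  refine sq_le_sq' ?_ ?_
  · linarith [neg_abs_le r, le_abs_self (a δ)]
  · linarith [le_abs_self r, neg_abs_le (a δ)]

/-- Any bound for the squared affine residual on a ball is at least its worst-case value. -/
theorem sq_abs_add_mul_opNorm_le {E : Type*} [NormedAddCommGroup E] [NormedSpace ℝ E]
    (a : E →L[ℝ] ℝ) (r : ℝ) {ξ S : ℝ} (hξ : 0 ≤ ξ)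
    (hS : ∀ δ : E, ‖δ‖ ≤ ξ → (r - a δ) ^ 2 ≤ S) :
    (|r| + ξ * ‖a‖) ^ 2 ≤ S := by
  have hr : r ^ 2 ≤ S := by simpa using hS 0 (by simpa using hξ)
  have hS0 : 0 ≤ S := (sq_nonneg r).trans hr
  have hr' : |r| ≤ √S := Real.abs_le_sqrt hr
  have key : ‖ξ • a‖ ≤ √S - |r| := by
    refine ContinuousLinearMap.opNorm_le_of_unit_norm (sub_nonneg.2 hr') fun u hu => ?_
    have hball : ‖ξ • u‖ ≤ ξ := by simp [norm_smul, hu, abs_of_nonneg hξ]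
    have h₁ := abs_le.1 (Real.abs_le_sqrt (hS (ξ • u) hball))
    have h₂ := abs_le.1 (Real.abs_le_sqrt (hS (-(ξ • u)) (by rwa [norm_neg])))
    simp only [map_neg, map_smul, smul_eq_mul] at h₁ h₂
    simp only [smul_apply, smul_eq_mul, Real.norm_eq_abs]
    rcases abs_cases r with h | h <;> rw [abs_le] <;> constructor <;> linarith
  rw [norm_smul, Real.norm_of_nonneg hξ] at key
  exact (Real.le_sqrt (by positivity) hS0).1 (by linarith)

theorem statement16 {E : Type*} [NormedAddCommGroup E] [NormedSpace ℝ E]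
    (a : E →L[ℝ] ℝ) (x : E) (b y ξ : ℝ) (hξ : 0 ≤ ξ) :
    (⨆ δ : {δ : E // ‖δ‖ ≤ ξ}, (y - (a (x + δ.1) + b)) ^ 2) =
      (|y - (a x + b)| + ξ * ‖a‖) ^ 2 := by
  have hres (δ : E) : y - (a (x + δ) + b) = y - (a x + b) - a δ := by
    rw [map_add]
    ring
  simp only [hres]
  have : Nonempty {δ : E // ‖δ‖ ≤ ξ} := ⟨⟨0, by simpa using hξ⟩⟩
  have hle (δ : {δ : E // ‖δ‖ ≤ ξ}) := sq_sub_apply_le a (y - (a x + b)) δ.2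
  refine le_antisymm (ciSup_le hle) (sq_abs_add_mul_opNorm_le a _ hξ fun δ hδ => ?_)
  exact le_ciSup (f := fun δ : {δ : E // ‖δ‖ ≤ ξ} => (y - (a x + b) - a δ.1) ^ 2)
    ⟨_, Set.forall_mem_range.2 hle⟩ ⟨δ, hδ⟩
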